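/- For any connected planar graph G on n vertices with maximum degree 4, the cut-width of G is O(√n); in particular there is a linear arrangement of the vertices such that at most c·√n edges cross any gap, for some universal constant c. -/

import Mathlib

/-- `H` is a minor of `G`: there are pairwise disjoint nonempty connected
branch sets in `G`, one for each vertex of `H`, with adjacent vertices of `H`
having an edge of `G` between the corresponding branch sets. -/
def SimpleGraph.IsMinorOf {W V : Type} (H : SimpleGraph W) (G : SimpleGraph V) : Prop :=
  ∃ f : W → Set V,
    (∀ w, (f w).Nonempty) ∧
    (∀ w, (G.induce (f w)).Connected) ∧
    (∀ w w', w ≠ w' → Disjoint (f w) (f w')) ∧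
    (∀ w w', H.Adj w w' → ∃ a ∈ f w, ∃ b ∈ f w', G.Adj a b)

/-- Planarity, via Wagner's characterization: a graph is planar iff it has
neither `K₅` nor `K₃,₃` as a minor. -/
def SimpleGraph.IsPlanar {V : Type} (G : SimpleGraph V) : Prop :=
  ¬ (completeGraph (Fin 5)).IsMinorOf G ∧
  ¬ (completeBipartiteGraph (Fin 3) (Fin 3)).IsMinorOf G

set_option linter.unusedSectionVars false
namespace PCW
variable {V : Type} [DecidableEq V]

def Cn (G : SimpleGraph V) (S : Finset V) : Prop := (G.induce (S : Set V)).Connected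

lemma Cn.nonempty {G : SimpleGraph V} {S : Finset V} (h : Cn G S) : S.Nonempty := by
  obtain ⟨x⟩ := SimpleGraph.Connected.nonempty h
  exact ⟨x.1, x.2⟩

lemma cn_singleton (G : SimpleGraph V) (v : V) : Cn G {v} := by
  unfold Cn
  rw [Finset.coe_singleton]
  have : Unique (({v} : Set V) : Type) := Set.uniqueSingleton v
  have : Nonempty (({v} : Set V) : Type) := ⟨⟨v, rfl⟩⟩
  refine { preconnected := ?_ }
  intro a b
  rw [Subsingleton.elim a b]

lemma Cn.union {G : SimpleGraph V} {S T : Finset V} (hS : Cn G S) (hT : Cn G T)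
    {v : V} (h1 : v ∈ S) (h2 : v ∈ T) : Cn G (S ∪ T) := by
  unfold Cn
  rw [Finset.coe_union]
  exact SimpleGraph.induce_union_connected hS.preconnected hT.preconnected ⟨v, h1, h2⟩

lemma Cn.cut {G : SimpleGraph V} {S P : Finset V} (hS : Cn G S) {p q : V}
    (hp : p ∈ S) (hpP : p ∈ P) (hq : q ∈ S) (hqP : q ∉ P) :
    ∃ a ∈ S, a ∈ P ∧ ∃ b ∈ S, b ∉ P ∧ G.Adj a b := by
  obtain ⟨w⟩ := hS.preconnected ⟨p, hp⟩ ⟨q, hq⟩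
  obtain ⟨d, -, h1, h2⟩ := w.exists_boundary_dart {x | x.1 ∈ P} hpP hqP
  exact ⟨d.fst.1, d.fst.2, h1, d.snd.1, d.snd.2, h2, d.adj⟩

lemma Cn.ins {G : SimpleGraph V} {S : Finset V} (hS : Cn G S) {u v : V}
    (hu : u ∈ S) (h : G.Adj u v) : Cn G (insert v S) := by
  have h2 : Cn G {u, v} := by
    unfold Cn
    rw [Finset.coe_insert, Finset.coe_singleton]
    exact SimpleGraph.induce_pair_connected_of_adj h
  have := hS.union h2 hu (by simp)
  convert this using 1
  ext x; simp; grind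

lemma Cn.max {G : SimpleGraph V} {A S : Finset V} (hA : Cn G A) (h : A ⊆ S) :
    ∃ M, A ⊆ M ∧ M ⊆ S ∧ Cn G M ∧ ∀ m ∈ M, ∀ v ∈ S, v ∉ M → ¬ G.Adj m v := by
  induction hn : (S \ A).card using Nat.strong_induction_on generalizing A with
  | _ n ih =>
    by_cases hc : ∃ m ∈ A, ∃ v ∈ S, v ∉ A ∧ G.Adj m v
    · obtain ⟨m, hm, v, hv, hvA, hadj⟩ := hc
      have hlt : (S \ insert v A).card < n := by
        rw [← hn]
        apply Finset.card_lt_card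
        refine ⟨by grind, fun hh => ?_⟩
        have := hh (Finset.mem_sdiff.2 ⟨hv, hvA⟩)
        simp at this
      obtain ⟨M, h1, h2, h3⟩ := ih _ hlt (A := insert v A) (hA.ins hm hadj)
        (by grind) rfl
      exact ⟨M, by grind, h2, h3⟩
    · push Not at hc
      exact ⟨A, subset_rfl, h, hA, hc⟩

/-! balls -/
open Classical in
noncomputable def ball (G : SimpleGraph V) (A B : Finset V) : ℕ → Finset V
  | 0 => ∅
  | t + 1 => (A ∪ ball G A B t) ∪ B.filter (fun v => ∃ u ∈ ball G A B t, G.Adj u v)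

lemma ball_sub (G : SimpleGraph V) {A B : Finset V} (h : A ⊆ B) (t : ℕ) : ball G A B t ⊆ B := by
  induction t with
  | zero => simp [ball]
  | succ t ih => simp only [ball]; grind

lemma ball_mono (G : SimpleGraph V) (A B : Finset V) (t : ℕ) :
    ball G A B t ⊆ ball G A B (t+1) := by
  simp only [ball]; grind

lemma ball_tree (G : SimpleGraph V) {A B : Finset V} (h : A ⊆ B) (t : ℕ) (v : V)
    (hv : v ∈ ball G A B t) : ∃ T, Cn G T ∧ v ∈ T ∧ T ⊆ B ∧ (∃ a ∈ T, a ∈ A) ∧ T.card ≤ t := by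
  induction t generalizing v with
  | zero => simp [ball] at hv
  | succ t ih =>
    simp only [ball, Finset.mem_union, Finset.mem_filter] at hv
    rcases hv with (hv | hv) | ⟨hvB, u, hu, hadj⟩
    · exact ⟨{v}, cn_singleton G v, by simp, by simpa using h hv, ⟨v, by simp, hv⟩, by simp⟩
    · obtain ⟨T, h1, h2, h3, h4, h5⟩ := ih v hv
      exact ⟨T, h1, h2, h3, h4, by omega⟩
    · obtain ⟨T, h1, h2, h3, ⟨a, ha, haA⟩, h5⟩ := ih u hu
      exact ⟨insert v T, h1.ins h2 hadj, by simp, by grind, ⟨a, by simp [ha], haA⟩,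
        (Finset.card_insert_le _ _).trans (by omega)⟩

lemma ball_layer (G : SimpleGraph V) {A B : Finset V} (h : A ⊆ B) {r : ℕ} (hr : 0 < r)
    (hB : B.card ≤ r * r) :
    ∃ t < r, (ball G A B (t+1) \ ball G A B t).card ≤ r := by
  by_contra hc
  push Not at hc
  have key : ∀ t ≤ r, t * (r+1) ≤ (ball G A B t).card := by
    intro t
    induction t with
    | zero => simp
    | succ t ih =>
      intro ht
      have h1 := ih (by omega)
      have h2 := hc t (by omega)
      have h3 := Finset.card_sdiff_add_card_eq_card (ball_mono G A B t)
      rw [add_mul]; omega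
  have h1 := key r le_rfl
  have h2 := Finset.card_le_card (ball_sub G h r)
  nlinarith

lemma ball_comp (G : SimpleGraph V) {A B D : Finset V} {t : ℕ} (hD : Cn G D) (hDB : D ⊆ B)
    (hL : ∀ v ∈ D, v ∉ ball G A B (t+1) \ ball G A B t) (hA : ∃ a ∈ D, a ∈ A) :
    D ⊆ ball G A B t := by
  obtain ⟨a, haD, haA⟩ := hA
  have ha : a ∈ ball G A B t := by
    have := hL a haD
    have h2 : a ∈ ball G A B (t+1) := by simp [ball, haA]
    grind
  intro q hq
  by_contra hqb
  obtain ⟨x, hx, hxP, y, hy, hyP, hadj⟩ := hD.cut haD ha hq hqb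
  apply hL y hy
  simp only [Finset.mem_sdiff]
  refine ⟨?_, hyP⟩
  simp only [ball, Finset.mem_union, Finset.mem_filter]
  exact Or.inr ⟨hDB hy, x, hxP, hadj⟩

lemma glue {ι : Type} [DecidableEq ι] (G : SimpleGraph V) (A : ι → Finset V) (B : Finset V) (r : ℕ)
    (v : V) (hv : v ∈ B) (s : Finset ι)
    (h : ∀ i ∈ s, ∃ T, Cn G T ∧ v ∈ T ∧ T ⊆ B ∧ (∃ a ∈ T, a ∈ A i) ∧ T.card ≤ r) :
    ∃ T, Cn G T ∧ v ∈ T ∧ T ⊆ B ∧ (∀ i ∈ s, ∃ a ∈ T, a ∈ A i) ∧ T.card ≤ 1 + s.card * r := by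
  induction s using Finset.induction_on with
  | empty => exact ⟨{v}, cn_singleton G v, by simp, by simpa using hv, by simp, by simp⟩
  | insert i s hi ih =>
    obtain ⟨T, h1, h2, h3, h4, h5⟩ := ih (fun j hj => h j (by simp [hj]))
    obtain ⟨T', g1, g2, g3, ⟨a, ga, gA⟩, g5⟩ := h i (by simp)
    refine ⟨T ∪ T', h1.union g1 h2 g2, by simp [h2], by grind, ?_, ?_⟩
    · intro j hj
      rcases Finset.mem_insert.1 hj with rfl | hj
      · exact ⟨a, by simp [ga], gA⟩
      · obtain ⟨b, hb, hbA⟩ := h4 j hj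
        exact ⟨b, by simp [hb], hbA⟩
    · refine (Finset.card_union_le _ _).trans ?_
      rw [Finset.card_insert_of_notMem hi, add_mul]; omega

lemma ast {ι : Type} [DecidableEq ι] (G : SimpleGraph V) (s : Finset ι) (hs : s.card ≤ 4)
    (A : ι → Finset V) (B : Finset V) (hA : ∀ i ∈ s, A i ⊆ B) {r : ℕ} (hr : 0 < r)
    (hB : B.card ≤ r * r) :
    (∃ T, Cn G T ∧ T ⊆ B ∧ (∀ i ∈ s, ∃ a ∈ T, a ∈ A i) ∧ T.card ≤ 5 * r) ∨
    (∃ Z, Z ⊆ B ∧ Z.card ≤ 5 * r ∧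
      ∀ D, Cn G D → D ⊆ B → Disjoint D Z → ∃ i ∈ s, Disjoint D (A i)) := by
  by_cases hT : ∃ T, Cn G T ∧ T ⊆ B ∧ (∀ i ∈ s, ∃ a ∈ T, a ∈ A i) ∧ T.card ≤ 5 * r
  · exact Or.inl hT
  right
  have hl : ∀ i, ∃ t, i ∈ s → t < r ∧ (ball G (A i) B (t+1) \ ball G (A i) B t).card ≤ r := by
    intro i
    by_cases hi : i ∈ s
    · obtain ⟨t, h1, h2⟩ := ball_layer G (hA i hi) hr hB
      exact ⟨t, fun _ => ⟨h1, h2⟩⟩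
    · exact ⟨0, fun h => absurd h hi⟩
  choose t ht using hl
  refine ⟨s.biUnion fun i => ball G (A i) B (t i + 1) \ ball G (A i) B (t i), ?_, ?_, ?_⟩
  · intro v hv
    simp only [Finset.mem_biUnion, Finset.mem_sdiff] at hv
    obtain ⟨i, hi, h1, -⟩ := hv
    exact ball_sub G (hA i hi) _ h1
  · refine (Finset.card_biUnion_le_card_mul s _ r (fun i hi => (ht i hi).2)).trans ?_
    nlinarith
  · intro D hD hDB hdis
    by_contra hc
    push Not at hc
    apply hT
    obtain ⟨v, hv⟩ := hD.nonempty
    obtain ⟨T, h1, h2, h3, h4, h5⟩ := glue G A B r v (hDB hv) s (by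
      intro i hi
      have hm : ∃ a ∈ D, a ∈ A i := Finset.not_disjoint_iff.1 (hc i hi)
      have := ball_comp G (t := t i) hD hDB (fun w hw hw2 =>
        Finset.disjoint_left.1 hdis hw (Finset.mem_biUnion.2 ⟨i, hi, hw2⟩)) hm
      obtain ⟨T, h1, h2, h3, h4, h5⟩ := ball_tree G (hA i hi) _ v (this hv)
      exact ⟨T, h1, h2, h3, h4, h5.trans (ht i hi).1.le⟩)
    exact ⟨T, h1, h3, h4, by nlinarith⟩
end PCW

namespace PCW
variable {V : Type} [DecidableEq V]

def NoK5 (G : SimpleGraph V) : Prop := ¬ (SimpleGraph.completeGraph (Fin 5)).IsMinorOf G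

structure St (G : SimpleGraph V) [DecidableRel G.Adj] (S : Finset V) (r : ℕ)
    (C : Finset (Finset V)) (B : Finset V) : Prop where
  sub : B ⊆ S
  conn : Cn G B
  big : S.card < 2 * B.card
  csub : ∀ c ∈ C, c ⊆ S
  cdis : ∀ c ∈ C, Disjoint c B
  cconn : ∀ c ∈ C, Cn G c
  pdis : ∀ c ∈ C, ∀ d ∈ C, c ≠ d → Disjoint c d
  padj : ∀ c ∈ C, ∀ d ∈ C, c ≠ d → ∃ x ∈ c, ∃ y ∈ d, G.Adj x y
  nb : ∀ b ∈ B, ∀ v ∈ S, v ∉ B → G.Adj b v → ∃ c ∈ C, v ∈ c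
  small : ∀ c ∈ C, (c.filter (fun v => ∃ b ∈ B, G.Adj b v)).card ≤ 5 * r

variable {G : SimpleGraph V} [DecidableRel G.Adj] {S B : Finset V} {r : ℕ} {C : Finset (Finset V)}

lemma St.card (h : St G S r C B) (hG : NoK5 G) : C.card ≤ 4 := by
  by_contra hc
  obtain ⟨D, hDC, hD⟩ := Finset.exists_subset_card_eq (show 5 ≤ C.card by omega)
  apply hG
  let e : Fin 5 ≃ D := (Finset.equivFinOfCardEq hD).symm
  have hm : ∀ i, (e i).1 ∈ C := fun i => hDC (e i).2
  have hne : ∀ i j, i ≠ j → (e i).1 ≠ (e j).1 := fun i j hij hh =>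
    hij (e.injective (Subtype.ext hh))
  refine ⟨fun i => ((e i).1 : Set V), ?_, ?_, ?_, ?_⟩
  · intro i
    exact (h.cconn _ (hm i)).nonempty
  · intro i
    exact h.cconn _ (hm i)
  · intro i j hij
    rw [Finset.disjoint_coe]
    exact h.pdis _ (hm i) _ (hm j) (hne i j hij)
  · intro i j hij
    exact h.padj _ (hm i) _ (hm j) (hne i j hij.ne)

lemma St.step (h : St G S r C B) (hG : NoK5 G) (hr : 0 < r) (hS : S.card ≤ r * r)
    (hsep : ∀ X : Finset V, X ⊆ S → X.card ≤ 25 * r →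
      ∃ D, Cn G D ∧ D ⊆ S ∧ Disjoint D X ∧ S.card < 2 * D.card) :
    ∃ C' B', St G S r C' B' ∧
      (B'.card < B.card ∨ (B'.card = B.card ∧ C'.card < C.card)) := by
  have hC4 := h.card hG
  let A : Finset V → Finset V := fun c => B.filter (fun b => ∃ v ∈ c, G.Adj b v)
  by_cases hemp : ∃ c ∈ C, A c = ∅
  · obtain ⟨c, hc, hA⟩ := hemp
    refine ⟨C.erase c, B, ⟨h.sub, h.conn, h.big, fun d hd => h.csub d (Finset.mem_of_mem_erase hd),
      fun d hd => h.cdis d (Finset.mem_of_mem_erase hd),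
      fun d hd => h.cconn d (Finset.mem_of_mem_erase hd),
      fun d hd e he => h.pdis d (Finset.mem_of_mem_erase hd) e (Finset.mem_of_mem_erase he),
      fun d hd e he => h.padj d (Finset.mem_of_mem_erase hd) e (Finset.mem_of_mem_erase he), ?_,
      fun d hd => h.small d (Finset.mem_of_mem_erase hd)⟩,
      Or.inr ⟨rfl, Finset.card_erase_lt_of_mem hc⟩⟩
    intro b hb v hv hvB hadj
    obtain ⟨d, hd, hvd⟩ := h.nb b hb v hv hvB hadj
    refine ⟨d, Finset.mem_erase.2 ⟨?_, hd⟩, hvd⟩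
    rintro rfl
    have : b ∈ A d := Finset.mem_filter.2 ⟨hb, v, hvd, hadj⟩
    rw [hA] at this
    simp at this
  push Not at hemp
  -- general separator step
  have sepstep : ∀ T : Finset V, T ⊆ B → T.card ≤ 5 * r →
      ∃ D, Cn G D ∧ D ⊆ B ∧ Disjoint D T ∧ S.card < 2 * D.card ∧
        (∀ d ∈ D, ∀ v ∈ B, v ∉ D → G.Adj d v → v ∈ T) := by
    intro T hTB hT
    let N := C.biUnion (fun c => c.filter (fun v => ∃ b ∈ B, G.Adj b v))
    have hNc : N.card ≤ 20 * r := by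
      refine (Finset.card_biUnion_le_card_mul C _ (5 * r) h.small).trans ?_
      nlinarith
    have hNS : N ⊆ S := by
      intro v hv
      obtain ⟨c, hc, hv⟩ := Finset.mem_biUnion.1 hv
      exact h.csub c hc (Finset.mem_filter.1 hv).1
    have hNB : ∀ b ∈ B, ∀ v ∈ S, v ∉ B → G.Adj b v → v ∈ N := by
      intro b hb v hv hvB hadj
      obtain ⟨c, hc, hvc⟩ := h.nb b hb v hv hvB hadj
      exact Finset.mem_biUnion.2 ⟨c, hc, Finset.mem_filter.2 ⟨hvc, b, hb, hadj⟩⟩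
    obtain ⟨D0, hD0, hD0S, hD0X, hD0b⟩ := hsep (N ∪ T)
      (Finset.union_subset hNS (hTB.trans h.sub))
      ((Finset.card_union_le _ _).trans (by omega))
    obtain ⟨D, hD0D, hDS, hD, hDmax⟩ := hD0.max (S := S \ (N ∪ T)) (by
      intro x hx
      exact Finset.mem_sdiff.2 ⟨hD0S hx, fun hh => Finset.disjoint_left.1 hD0X hx hh⟩)
    have hDb : S.card < 2 * D.card := by
      have := Finset.card_le_card hD0D
      omega
    have hmeet : ∃ x ∈ D, x ∈ B := by
      by_contra hno
      push Not at hno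
      have hdj : Disjoint D B := Finset.disjoint_left.2 hno
      have h1 := Finset.card_union_of_disjoint hdj
      have h2 : (D ∪ B).card ≤ S.card :=
        Finset.card_le_card (Finset.union_subset (hDS.trans Finset.sdiff_subset) h.sub)
      have h3 := h.big
      omega
    obtain ⟨x, hxD, hxB⟩ := hmeet
    have hDB : D ⊆ B := by
      intro q hq
      by_contra hqB
      obtain ⟨a, ha, haB, b, hb, hbB, hadj⟩ := hD.cut hxD hxB hq hqB
      have hbS := Finset.mem_sdiff.1 (hDS hb)
      exact hbS.2 (Finset.mem_union_left _ (hNB a haB b hbS.1 hbB hadj))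
    refine ⟨D, hD, hDB, ?_, hDb, ?_⟩
    · rw [Finset.disjoint_left]
      intro y hy hyT
      exact (Finset.mem_sdiff.1 (hDS hy)).2 (Finset.mem_union_right _ hyT)
    · intro d hd v hv hvD hadj
      by_contra hvT
      refine hDmax d hd v (Finset.mem_sdiff.2 ⟨h.sub hv, ?_⟩) hvD hadj
      intro hm
      rcases Finset.mem_union.1 hm with hm | hm
      · obtain ⟨c, hc, hvc⟩ := Finset.mem_biUnion.1 hm
        exact Finset.disjoint_left.1 (h.cdis c hc) (Finset.mem_filter.1 hvc).1 hv
      · exact hvT hm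
  rcases ast G C hC4 A B (fun c _ => Finset.filter_subset _ _) hr
    ((Finset.card_le_card h.sub).trans hS) with ⟨T, hT, hTB, hTA, hTc⟩ | ⟨Z, hZB, hZc, hZ⟩
  · obtain ⟨D, hD, hDB, hDT, hDb, hDn⟩ := sepstep T hTB hTc
    have hTadj : ∀ c ∈ C, ∃ x ∈ T, ∃ y ∈ c, G.Adj x y := by
      intro c hc
      obtain ⟨a, ha, haA⟩ := hTA c hc
      obtain ⟨-, y, hy, hadj⟩ := Finset.mem_filter.1 haA
      exact ⟨a, ha, y, hy, hadj⟩
    have hTdis : ∀ c ∈ C, Disjoint T c := fun c hc =>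
      ((h.cdis c hc).mono_right hTB).symm
    refine ⟨insert T C, D, ⟨hDB.trans h.sub, hD, hDb, ?_, ?_, ?_, ?_, ?_, ?_, ?_⟩, Or.inl ?_⟩
    · intro c hc
      rcases Finset.mem_insert.1 hc with rfl | hc
      · exact hTB.trans h.sub
      · exact h.csub c hc
    · intro c hc
      rcases Finset.mem_insert.1 hc with rfl | hc
      · exact hDT.symm
      · exact (h.cdis c hc).mono_right hDB
    · intro c hc
      rcases Finset.mem_insert.1 hc with rfl | hc
      · exact hT
      · exact h.cconn c hc
    · intro c hc d hd hcd
      rcases Finset.mem_insert.1 hc with hc' | hc' <;> rcases Finset.mem_insert.1 hd with hd' | hd'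
      · exact absurd (hc'.trans hd'.symm) hcd
      · rw [hc']; exact hTdis d hd'
      · rw [hd']; exact (hTdis c hc').symm
      · exact h.pdis c hc' d hd' hcd
    · intro c hc d hd hcd
      rcases Finset.mem_insert.1 hc with hc' | hc' <;> rcases Finset.mem_insert.1 hd with hd' | hd'
      · exact absurd (hc'.trans hd'.symm) hcd
      · rw [hc']; exact hTadj d hd'
      · rw [hd']
        obtain ⟨x, hx, y, hy, hadj⟩ := hTadj c hc'
        exact ⟨y, hy, x, hx, hadj.symm⟩
      · exact h.padj c hc' d hd' hcd
    · intro b hb v hv hvD hadj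
      by_cases hvB : v ∈ B
      · exact ⟨T, by simp, hDn b hb v hvB hvD hadj⟩
      · obtain ⟨c, hc, hvc⟩ := h.nb b (hDB hb) v hv hvB hadj
        exact ⟨c, by simp [hc], hvc⟩
    · intro c hc
      rcases Finset.mem_insert.1 hc with rfl | hc
      · exact (Finset.card_filter_le _ _).trans hTc
      · refine le_trans (Finset.card_le_card ?_) (h.small c hc)
        intro v hv
        obtain ⟨h1, b, hb, hadj⟩ := Finset.mem_filter.1 hv
        exact Finset.mem_filter.2 ⟨h1, b, hDB hb, hadj⟩
    · obtain ⟨t, ht⟩ := hT.nonempty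
      exact Finset.card_lt_card ⟨hDB, fun hh => Finset.disjoint_left.1 hDT (hh (hTB ht)) ht⟩
  · obtain ⟨D, hD, hDB, hDZ, hDb, hDn⟩ := sepstep Z hZB hZc
    obtain ⟨c, hc, hDA⟩ := hZ D hD hDB hDZ
    obtain ⟨K, hcK, hKs, hK, hKmax⟩ := (h.cconn c hc).max (S := c ∪ (B \ D))
      Finset.subset_union_left
    have hDK : Disjoint D K := by
      rw [Finset.disjoint_left]
      intro x hx hxK
      rcases Finset.mem_union.1 (hKs hxK) with h1 | h1
      · exact Finset.disjoint_left.1 (h.cdis c hc) h1 (hDB hx)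
      · exact (Finset.mem_sdiff.1 h1).2 hx
    have hDD' : D ⊆ B \ K := fun x hx =>
      Finset.mem_sdiff.2 ⟨hDB hx, Finset.disjoint_left.1 hDK hx⟩
    have hD'B : B \ K ⊆ B := Finset.sdiff_subset
    have hD'conn : Cn G (B \ K) := by
      obtain ⟨M, hDM, hMs, hM, hMmax⟩ := hD.max hDD'
      have : M = B \ K := by
        refine Finset.Subset.antisymm hMs ?_
        intro p hp
        by_contra hpM
        obtain ⟨x, hx⟩ := hD.nonempty
        obtain ⟨a, ha, haP, b, hb, hbP, hadj⟩ := h.conn.cut (P := (B \ K) \ M) (hD'B hp)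
          (Finset.mem_sdiff.2 ⟨hp, hpM⟩) (hDB hx)
          (fun hh => (Finset.mem_sdiff.1 hh).2 (hDM hx))
        obtain ⟨haK, haM⟩ := Finset.mem_sdiff.1 haP
        by_cases hbK : b ∈ K
        · refine hKmax b hbK a ?_ (Finset.mem_sdiff.1 haK).2 hadj.symm
          exact Finset.mem_union_right _ (Finset.mem_sdiff.2 ⟨ha, fun hh => haM (hDM hh)⟩)
        · have hbM : b ∈ M := by
            by_contra hbM
            exact hbP (Finset.mem_sdiff.2 ⟨Finset.mem_sdiff.2 ⟨hb, hbK⟩, hbM⟩)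
          exact hMmax b hbM a haK haM hadj.symm
      rwa [← this]
    have hKdis : ∀ d ∈ C, d ≠ c → Disjoint K d := by
      intro d hd hdc
      rw [Finset.disjoint_left]
      intro x hx hxd
      rcases Finset.mem_union.1 (hKs hx) with h1 | h1
      · exact Finset.disjoint_left.1 (h.pdis c hc d hd hdc.symm) h1 hxd
      · exact Finset.disjoint_left.1 (h.cdis d hd) hxd (Finset.mem_sdiff.1 h1).1
    have hKadj : ∀ d ∈ C, d ≠ c → ∃ x ∈ K, ∃ y ∈ d, G.Adj x y := by
      intro d hd hdc
      obtain ⟨x, hx, y, hy, hadj⟩ := h.padj c hc d hd hdc.symm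
      exact ⟨x, hcK hx, y, hy, hadj⟩
    have mem' : ∀ d, d ∈ insert K (C.erase c) → d = K ∨ (d ∈ C ∧ d ≠ c) := by
      intro d hd
      rcases Finset.mem_insert.1 hd with hd | hd
      · exact Or.inl hd
      · exact Or.inr ⟨Finset.mem_of_mem_erase hd, Finset.ne_of_mem_erase hd⟩
    refine ⟨insert K (C.erase c), B \ K,
      ⟨hD'B.trans h.sub, hD'conn, ?_, ?_, ?_, ?_, ?_, ?_, ?_, ?_⟩, Or.inl ?_⟩
    · have := Finset.card_le_card hDD'
      omega
    · intro d hd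
      rcases mem' d hd with rfl | ⟨hd, -⟩
      · exact hKs.trans (Finset.union_subset (h.csub c hc) (Finset.sdiff_subset.trans h.sub))
      · exact h.csub d hd
    · intro d hd
      rcases mem' d hd with rfl | ⟨hd, -⟩
      · exact Finset.disjoint_sdiff
      · exact (h.cdis d hd).mono_right hD'B
    · intro d hd
      rcases mem' d hd with rfl | ⟨hd, -⟩
      · exact hK
      · exact h.cconn d hd
    · intro d hd e he hde
      rcases mem' d hd with hd' | ⟨hd', hdc⟩ <;> rcases mem' e he with he' | ⟨he', hec⟩
      · exact absurd (hd'.trans he'.symm) hde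
      · rw [hd']; exact hKdis e he' hec
      · rw [he']; exact (hKdis d hd' hdc).symm
      · exact h.pdis d hd' e he' hde
    · intro d hd e he hde
      rcases mem' d hd with hd' | ⟨hd', hdc⟩ <;> rcases mem' e he with he' | ⟨he', hec⟩
      · exact absurd (hd'.trans he'.symm) hde
      · rw [hd']; exact hKadj e he' hec
      · rw [he']
        obtain ⟨x, hx, y, hy, hadj⟩ := hKadj d hd' hdc
        exact ⟨y, hy, x, hx, hadj.symm⟩
      · exact h.padj d hd' e he' hde
    · intro b hb v hv hvD hadj
      by_cases hvB : v ∈ B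
      · refine ⟨K, by simp, ?_⟩
        by_contra hvK
        exact hvD (Finset.mem_sdiff.2 ⟨hvB, hvK⟩)
      · obtain ⟨d, hd, hvd⟩ := h.nb b (hD'B hb) v hv hvB hadj
        by_cases hdc : d = c
        · subst hdc
          exact ⟨K, by simp, hcK hvd⟩
        · exact ⟨d, Finset.mem_insert_of_mem (Finset.mem_erase.2 ⟨hdc, hd⟩), hvd⟩
    · intro d hd
      rcases mem' d hd with rfl | ⟨hd, hdc⟩
      · refine le_trans (Finset.card_le_card ?_) hZc
        intro v hv
        obtain ⟨hvK, b, hb, hadj⟩ := Finset.mem_filter.1 hv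
        obtain ⟨hbB, hbK⟩ := Finset.mem_sdiff.1 hb
        have hbD : b ∈ D := by
          by_contra hbD
          exact hKmax v hvK b (Finset.mem_union_right _ (Finset.mem_sdiff.2 ⟨hbB, hbD⟩)) hbK
            hadj.symm
        have hvc : v ∉ c := fun hvc =>
          Finset.disjoint_left.1 hDA hbD (Finset.mem_filter.2 ⟨hbB, v, hvc, hadj⟩)
        have hvBD : v ∈ B \ D := by
          rcases Finset.mem_union.1 (hKs hvK) with h1 | h1
          · exact absurd h1 hvc
          · exact h1
        obtain ⟨hvB, hvD⟩ := Finset.mem_sdiff.1 hvBD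
        exact hDn b hbD v hvB hvD hadj
      · refine le_trans (Finset.card_le_card ?_) (h.small d hd)
        intro v hv
        obtain ⟨h1, b, hb, hadj⟩ := Finset.mem_filter.1 hv
        exact Finset.mem_filter.2 ⟨h1, b, hD'B hb, hadj⟩
    · obtain ⟨a, ha⟩ := hemp c hc
      obtain ⟨haB, v, hvc, hadj⟩ := Finset.mem_filter.1 ha
      have haD : a ∉ D := fun hh => Finset.disjoint_left.1 hDA hh ha
      refine Finset.card_lt_card ⟨hD'B, fun hh => ?_⟩
      have haK := (Finset.mem_sdiff.1 (hh haB)).2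
      exact hKmax v (hcK hvc) a (Finset.mem_union_right _ (Finset.mem_sdiff.2 ⟨haB, haD⟩)) haK
        hadj.symm

lemma St.absurd (hG : NoK5 G) (hr : 0 < r) (hS : S.card ≤ r * r)
    (hsep : ∀ X : Finset V, X ⊆ S → X.card ≤ 25 * r →
      ∃ D, Cn G D ∧ D ⊆ S ∧ Disjoint D X ∧ S.card < 2 * D.card) (n : ℕ) :
    ∀ (C : Finset (Finset V)) (B : Finset V), St G S r C B → 5 * B.card + C.card = n → False := by
  induction n using Nat.strong_induction_on with
  | _ n ih =>
    intro C B h hn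
    obtain ⟨C', B', h', hlt⟩ := h.step hG hr hS hsep
    have h4 := h'.card hG
    exact ih _ (by omega) C' B' h' rfl

theorem separator (hG : NoK5 G) (hr : 0 < r) (hS : S.card ≤ r * r) :
    ∃ X : Finset V, X ⊆ S ∧ X.card ≤ 25 * r ∧
      ∀ D, Cn G D → D ⊆ S → Disjoint D X → 2 * D.card ≤ S.card := by
  by_contra hc
  push Not at hc
  obtain ⟨D0, h1, h2, -, h3⟩ := hc ∅ (by simp) (by simp)
  obtain ⟨B, hDB, hBS, hB, hBmax⟩ := h1.max h2
  have := Finset.card_le_card hDB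
  exact St.absurd hG hr hS hc _ ∅ B ⟨hBS, hB, by omega, by simp, by simp, by simp, by simp,
    by simp, fun b hb v hv hvB hadj => (hBmax b hb v hv hvB hadj).elim, by simp⟩ rfl

/-- layouts -/
def Lay (G : SimpleGraph V) [DecidableRel G.Adj] (S : Finset V) (w : ℝ) : Prop :=
  ∃ l : List V, l.Nodup ∧ l.toFinset = S ∧
    ∀ l1 l2, l = l1 ++ l2 → ((G.interedges l1.toFinset l2.toFinset).card : ℝ) ≤ w

lemma Lay.mono {w w' : ℝ} (h : Lay G S w) (hw : w ≤ w') : Lay G S w' := by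
  obtain ⟨l, h1, h2, h3⟩ := h
  exact ⟨l, h1, h2, fun a b hab => (h3 a b hab).trans hw⟩

lemma Lay.empty {w : ℝ} (hw : 0 ≤ w) : Lay G ∅ w := by
  refine ⟨[], by simp, by simp, ?_⟩
  intro l1 l2 h
  obtain ⟨rfl, rfl⟩ := List.append_eq_nil_iff.1 h.symm
  simpa using hw

lemma Lay.union {A B : Finset V} {w : ℝ} (hA : Lay G A w) (hB : Lay G B w) (hd : Disjoint A B)
    (hn : ∀ a ∈ A, ∀ b ∈ B, ¬ G.Adj a b) : Lay G (A ∪ B) w := by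
  obtain ⟨l, h1, h2, h3⟩ := hA
  obtain ⟨m, g1, g2, g3⟩ := hB
  refine ⟨l ++ m, ?_, by simp [h2, g2], ?_⟩
  · refine List.Nodup.append h1 g1 ?_
    intro x hx hy
    exact Finset.disjoint_left.1 hd (h2 ▸ List.mem_toFinset.2 hx) (g2 ▸ List.mem_toFinset.2 hy)
  · intro l1 l2 hl
    rcases List.append_eq_append_iff.1 hl with ⟨as, rfl, rfl⟩ | ⟨bs, rfl, rfl⟩
    · refine le_trans ?_ (g3 as l2 rfl)
      norm_cast
      apply Finset.card_le_card
      rintro ⟨x, y⟩ hxy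
      rw [SimpleGraph.mem_interedges_iff] at hxy ⊢
      obtain ⟨hx, hy, hadj⟩ := hxy
      refine ⟨?_, hy, hadj⟩
      rw [List.toFinset_append, Finset.mem_union] at hx
      rcases hx with hx | hx
      · refine absurd hadj (hn x (h2 ▸ hx) y ?_)
        rw [← g2]; simp at hy ⊢; simp [hy]
      · exact hx
    · refine le_trans ?_ (h3 l1 bs rfl)
      norm_cast
      apply Finset.card_le_card
      rintro ⟨x, y⟩ hxy
      rw [SimpleGraph.mem_interedges_iff] at hxy ⊢
      obtain ⟨hx, hy, hadj⟩ := hxy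
      refine ⟨hx, ?_, hadj⟩
      rw [List.toFinset_append, Finset.mem_union] at hy
      rcases hy with hy | hy
      · exact hy
      · refine absurd hadj (hn x ?_ y (g2 ▸ hy))
        rw [← h2]; simp at hx ⊢; simp [hx]

lemma Lay.comps {w : ℝ} (hw : 0 ≤ w) (S : Finset V)
    (h : ∀ T, T ⊆ S → Cn G T → Lay G T w) : Lay G S w := by
  induction hn : S.card using Nat.strong_induction_on generalizing S with
  | _ n ih =>
    rcases S.eq_empty_or_nonempty with rfl | ⟨v, hv⟩
    · exact Lay.empty hw
    · obtain ⟨M, hvM, hMS, hM, hmax⟩ := (cn_singleton G v).max (S := S) (by simpa using hv)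
      have hvM' : v ∈ M := hvM (by simp)
      have h1 : Lay G (S \ M) w := ih (S \ M).card (by
        rw [← hn]
        exact Finset.card_lt_card ⟨Finset.sdiff_subset,
          fun hh => (Finset.mem_sdiff.1 (hh hv)).2 hvM'⟩) (S \ M)
          (fun T hT hc => h T (hT.trans Finset.sdiff_subset) hc) rfl
      have := (h M hMS hM).union h1 Finset.disjoint_sdiff (fun a ha b hb =>
        hmax a ha b (Finset.mem_sdiff.1 hb).1 (Finset.mem_sdiff.1 hb).2)
      rwa [Finset.union_sdiff_of_subset hMS] at this

variable [Fintype V]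

lemma deg_bound (hdeg : ∀ v, G.degree v ≤ 4) (X : Finset V) :
    (G.interedges X Finset.univ).card ≤ 4 * X.card := by
  have : G.interedges X Finset.univ ⊆
      X.biUnion (fun x => (G.neighborFinset x).image (fun y => (x, y))) := by
    rintro ⟨x, y⟩ h
    rw [SimpleGraph.mem_interedges_iff] at h
    simp only [Finset.mem_biUnion, Finset.mem_image]
    exact ⟨x, h.1, y, by simpa using h.2.2, rfl⟩
  refine (Finset.card_le_card this).trans ?_
  rw [mul_comm]
  refine Finset.card_biUnion_le_card_mul _ _ _ (fun x _ => ?_)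
  exact Finset.card_image_le.trans (hdeg x)

lemma deg_bound' (hdeg : ∀ v, G.degree v ≤ 4) (X : Finset V) :
    (G.interedges Finset.univ X).card ≤ 4 * X.card := by
  refine le_trans (le_of_eq ?_) (deg_bound hdeg X)
  refine Finset.card_bij (fun p _ => p.swap) ?_ ?_ ?_
  · rintro ⟨x, y⟩ h
    rw [SimpleGraph.mem_interedges_iff] at h
    simp only [Prod.swap_prod_mk, SimpleGraph.mem_interedges_iff]
    exact ⟨h.2.1, by simp, h.2.2.symm⟩
  · intro a _ b _ hab
    exact Prod.swap_injective hab
  · rintro ⟨x, y⟩ h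
    rw [SimpleGraph.mem_interedges_iff] at h
    refine ⟨(y, x), ?_, rfl⟩
    rw [SimpleGraph.mem_interedges_iff]
    exact ⟨by simp, h.1, h.2.2.symm⟩

lemma Lay.addX (hdeg : ∀ v, G.degree v ≤ 4) {A X : Finset V} {w : ℝ} (hA : Lay G A w)
    (hd : Disjoint A X) : Lay G (A ∪ X) (w + 8 * X.card) := by
  obtain ⟨l, h1, h2, h3⟩ := hA
  have hw : 0 ≤ w := le_trans (Nat.cast_nonneg _) (h3 [] l rfl)
  refine ⟨l ++ X.toList, ?_, by simp [h2], ?_⟩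
  · refine List.Nodup.append h1 X.nodup_toList ?_
    intro x hx hy
    exact Finset.disjoint_left.1 hd (h2 ▸ List.mem_toFinset.2 hx) (Finset.mem_toList.1 hy)
  · intro l1 l2 hl
    have hb := deg_bound hdeg X
    have hb' := deg_bound' hdeg X
    rcases List.append_eq_append_iff.1 hl with ⟨as, rfl, hX⟩ | ⟨bs, rfl, rfl⟩
    · have : G.interedges (l ++ as).toFinset l2.toFinset ⊆ G.interedges Finset.univ X := by
        apply SimpleGraph.interedges_mono
        · simp
        · intro y hy
          rw [← Finset.mem_toList, hX]
          simp at hy ⊢; simp [hy]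
      have h4 := (Finset.card_le_card this).trans hb'
      have h5 : ((G.interedges (l ++ as).toFinset l2.toFinset).card : ℝ) ≤ 4 * X.card := by
        exact_mod_cast h4
      have : (0:ℝ) ≤ X.card := Nat.cast_nonneg _
      linarith
    · have : G.interedges l1.toFinset (bs ++ X.toList).toFinset ⊆
          G.interedges l1.toFinset bs.toFinset ∪ G.interedges Finset.univ X := by
        rintro ⟨x, y⟩ hxy
        rw [Finset.mem_union]
        simp only [SimpleGraph.mem_interedges_iff] at hxy ⊢
        obtain ⟨hx, hy, hadj⟩ := hxy
        rw [List.toFinset_append, Finset.mem_union] at hy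
        rcases hy with hy | hy
        · exact Or.inl ⟨hx, hy, hadj⟩
        · exact Or.inr ⟨by simp, by simpa using hy, hadj⟩
      have h4 := (Finset.card_le_card this).trans (Finset.card_union_le _ _)
      have h5 : ((G.interedges l1.toFinset (bs ++ X.toList).toFinset).card : ℝ) ≤
          (G.interedges l1.toFinset bs.toFinset).card + 4 * X.card := by
        exact_mod_cast h4.trans (by omega)
      have := h3 l1 bs rfl
      have : (0:ℝ) ≤ X.card := Nat.cast_nonneg _
      linarith

lemma layout (hG : NoK5 G) (hdeg : ∀ v, G.degree v ≤ 4) (S : Finset V) :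
    Lay G S (1600 * √(S.card : ℝ)) := by
  induction hn : S.card using Nat.strong_induction_on generalizing S with
  | _ n ih =>
    rcases S.eq_empty_or_nonempty with rfl | hne
    · exact Lay.empty (by positivity)
    have hpos : 0 < S.card := hne.card_pos
    obtain ⟨X, hXS, hXc, hX⟩ := separator (S := S) (r := Nat.sqrt n + 1) hG (by omega)
      (by rw [hn]; exact (Nat.lt_succ_sqrt n).le)
    have hLay : Lay G (S \ X) (1600 * √((n : ℝ) / 2)) := by
      refine Lay.comps (by positivity) _ ?_
      intro T hT hTc
      have h2 := hX T hTc (hT.trans Finset.sdiff_subset)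
        (Finset.disjoint_of_subset_left hT Finset.sdiff_disjoint)
      refine (ih T.card (by omega) T rfl).mono ?_
      have : (2 : ℝ) * T.card ≤ n := by rw [← hn]; exact_mod_cast h2
      gcongr
      linarith
    have := hLay.addX hdeg Finset.sdiff_disjoint
    rw [Finset.sdiff_union_of_subset hXS] at this
    refine this.mono ?_
    have hn1 : (1:ℝ) ≤ n := by exact_mod_cast (by omega : 1 ≤ n)
    have hs1 : (1:ℝ) ≤ √(n:ℝ) := by rw [Real.one_le_sqrt]; exact hn1
    have hs2 : (Nat.sqrt n : ℝ) ≤ √(n:ℝ) := Real.nat_sqrt_le_real_sqrt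
    have hX2 : (X.card : ℝ) ≤ 25 * (Nat.sqrt n + 1) := by exact_mod_cast hXc
    have hhalf : √((n:ℝ)/2) ≤ 3/4 * √(n:ℝ) := by
      rw [Real.sqrt_le_iff]
      refine ⟨by positivity, ?_⟩
      rw [mul_pow, Real.sq_sqrt (by positivity)]
      nlinarith
    linarith

end PCW

theorem planar_cutwidth_sqrt :
    ∃ c : ℕ, ∀ (V : Type) [Fintype V] [DecidableEq V]
      (G : SimpleGraph V) [DecidableRel G.Adj],
      G.IsPlanar → G.Connected → (∀ v : V, G.degree v ≤ 4) →
      ∃ σ : Fin (Fintype.card V) ≃ V,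
        ∀ i : ℕ,
          (Finset.univ.filter fun p : V × V =>
              G.Adj p.1 p.2 ∧ ((σ.symm p.1 : ℕ) ≤ i ∧ i < (σ.symm p.2 : ℕ))).card
            ≤ c * (Nat.sqrt (Fintype.card V) + 1) := by
  refine ⟨1600, ?_⟩
  intro V _ _ G _ hG _ hdeg
  obtain ⟨l, hnd, hl, hcut⟩ := PCW.layout hG.1 hdeg Finset.univ
  have hmem : ∀ x, x ∈ l := fun x => by
    rw [← List.mem_toFinset, hl]; simp
  have hlen : Fintype.card V = l.length := by
    rw [← Finset.card_univ, ← hl, List.toFinset_card_of_nodup hnd]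
  let e : Fin l.length ≃ V := hnd.getEquivOfForallMemList l hmem
  refine ⟨(finCongr hlen).trans e, ?_⟩
  intro i
  have h1 := hcut (l.take (i+1)) (l.drop (i+1)) (List.take_append_drop _ _).symm
  have key : ∀ x, ((((finCongr hlen).trans e).symm x : Fin _) : ℕ) = l.idxOf x := by
    intro x; rfl
  have hsub : (Finset.univ.filter fun p : V × V =>
      G.Adj p.1 p.2 ∧ ((((finCongr hlen).trans e).symm p.1 : ℕ) ≤ i ∧
        i < (((finCongr hlen).trans e).symm p.2 : ℕ))) ⊆
      G.interedges (l.take (i+1)).toFinset (l.drop (i+1)).toFinset := by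
    rintro ⟨x, y⟩ h
    simp only [Finset.mem_filter, Finset.mem_univ, true_and, key] at h
    obtain ⟨hadj, hx, hy⟩ := h
    rw [SimpleGraph.mem_interedges_iff]
    refine ⟨?_, ?_, hadj⟩
    · rw [List.mem_toFinset, List.mem_take_iff_idxOf_lt (hmem x)]
      omega
    · rw [List.mem_toFinset]
      have hm := hmem y
      rw [← List.take_append_drop (i+1) l, List.mem_append] at hm
      rcases hm with hm | hm
      · rw [List.mem_take_iff_idxOf_lt (hmem y)] at hm
        omega
      · exact hm
  refine (Finset.card_le_card hsub).trans ?_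
  have h2 : √((Finset.univ : Finset V).card : ℝ) ≤ (Nat.sqrt (Fintype.card V) : ℝ) + 1 := by
    rw [Finset.card_univ]
    exact Real.real_sqrt_le_nat_sqrt_succ
  have h3 : ((G.interedges (l.take (i+1)).toFinset (l.drop (i+1)).toFinset).card : ℝ) ≤
      1600 * ((Nat.sqrt (Fintype.card V) : ℝ) + 1) := by linarith
  exact_mod_cast h3
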